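/- Fix an integer k ≥ 3, s > 0, and distinct indices i ≠ j. For every t in the open simplex T = {t ∈ ℝ^k : t_m > 0 for all m, Σ_{m=1}^k t_m = 1}, the Dirichlet distribution dir_{s,t} satisfies E_{dir_{s,t}}[θ_i·θ_j] = s·t_i·t_j/(s+1), and consequently the upper expectation over the imprecise Dirichlet model's near-ignorance prior is sup_{t∈T} E_{dir_{s,t}}[θ_i·θ_j] = s/(4(s+1)), which is strictly smaller than sup_{θ∈Θ} θ_i·θ_j = 1/4; hence this near-ignorance prior does not give vacuous upper expectation to the function θ ↦ θ_i·θ_j. -/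

import Mathlib

open MeasureTheory Finset

/-- Parametrization of the standard simplex in `ℝ^k` by its first `k-1`
coordinates: `θ_j = y_j` for `j < k-1` and `θ_k = 1 - Σᵢ yᵢ`. -/
noncomputable def simplexExt (k : ℕ) (y : Fin (k - 1) → ℝ) : Fin k → ℝ :=
  fun j => if h : (j : ℕ) < k - 1 then y ⟨j, h⟩ else 1 - ∑ i, y i

/-- The parametrization domain: `y ∈ ℝ^{k-1}` with `yᵢ ≥ 0` and `Σᵢ yᵢ ≤ 1`. -/
def simplexDomain (k : ℕ) : Set (Fin (k - 1) → ℝ) :=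
  {y | (∀ i, 0 ≤ y i) ∧ ∑ i, y i ≤ 1}

/-- The expectation of `f` under the Dirichlet distribution `dir_{s,t}`, written as
an integral against the Dirichlet density
`Γ(s)/(∏ᵢ Γ(s tᵢ)) · ∏ᵢ θᵢ^{s tᵢ - 1}` with respect to `(k-1)`-dimensional
Lebesgue measure in the parametrization of the simplex by `(θ₁,…,θ_{k-1})`. -/
noncomputable def dirichletExpectation (k : ℕ) (s : ℝ) (t : Fin k → ℝ)
    (f : (Fin k → ℝ) → ℝ) : ℝ :=
  ∫ y in simplexDomain k,
    f (simplexExt k y) *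
      ((Real.Gamma s / ∏ i, Real.Gamma (s * t i)) *
        ∏ i, simplexExt k y i ^ (s * t i - 1)) ∂volume

/-- The power density `x ^ (a - 1) / Γ(a)` on `[0, ∞)`, extended by zero; these form a
convolution semigroup in `a`. -/
noncomputable def gammaPower (a x : ℝ) : ENNReal :=
  ENNReal.ofReal (if 0 ≤ x then x ^ (a - 1) / Real.Gamma a else 0)

@[fun_prop]
lemma measurable_gammaPower (a : ℝ) : Measurable (gammaPower a) := by
  unfold gammaPower
  exact (Measurable.ite measurableSet_Ici (by fun_prop) (by fun_prop)).ennreal_ofReal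

lemma gammaPower_of_neg (a : ℝ) {x : ℝ} (hx : x < 0) : gammaPower a x = 0 := by
  simp [gammaPower, hx.not_ge]

lemma gammaPower_scaled_mul {a b R u : ℝ} (ha : 0 < a) (hb : 0 < b) (hR : 0 < R)
    (hu₀ : u ≠ 0) (hu₁ : u ≠ 1) :
    ENNReal.ofReal R * (gammaPower a (R * u) * gammaPower b (R - R * u)) =
      gammaPower (a + b) R * ProbabilityTheory.betaPDF a b u := by
  have hRu : R - R * u = R * (1 - u) := by ring
  rcases lt_or_gt_of_ne hu₀ with h | h
  · rw [gammaPower_of_neg a (mul_neg_of_pos_of_neg hR h),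
      ProbabilityTheory.betaPDF_eq_zero_of_nonpos h.le]
    simp
  rcases lt_or_gt_of_ne hu₁ with h' | h'
  · have hv : 0 < 1 - u := by linarith
    have hGa := Real.Gamma_pos_of_pos ha
    have hGb := Real.Gamma_pos_of_pos hb
    have hGab := Real.Gamma_pos_of_pos (add_pos ha hb)
    rw [ProbabilityTheory.betaPDF_of_pos_lt_one h h', hRu]
    unfold gammaPower
    rw [if_pos (by positivity), if_pos (by positivity), if_pos hR.le,
      ← ENNReal.ofReal_mul (by positivity), ← ENNReal.ofReal_mul (by positivity),
      ← ENNReal.ofReal_mul (by positivity), Real.mul_rpow hR.le h.le, Real.mul_rpow hR.le hv.le,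
      show a + b - 1 = 1 + (a - 1) + (b - 1) by ring, Real.rpow_add hR, Real.rpow_add hR,
      Real.rpow_one, ProbabilityTheory.beta]
    congr 1
    field_simp
  · rw [hRu, gammaPower_of_neg b (mul_neg_of_pos_of_neg hR (by linarith)),
      ProbabilityTheory.betaPDF_eq_zero_of_one_le h'.le]
    simp

lemma lintegral_gammaPower_mul {a b R : ℝ} (ha : 0 < a) (hb : 0 < b) (hR : R ≠ 0) :
    ∫⁻ x, gammaPower a x * gammaPower b (R - x) = gammaPower (a + b) R := by
  rcases lt_or_gt_of_ne hR with h | h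
  · rw [gammaPower_of_neg _ h]
    refine (lintegral_congr fun x => ?_).trans lintegral_zero
    rcases lt_or_ge x 0 with hx | hx
    · simp [gammaPower_of_neg a hx]
    · simp [gammaPower_of_neg b (show R - x < 0 by linarith)]
  · have hmeas : Measurable fun x => gammaPower a x * gammaPower b (R - x) := by fun_prop
    rw [← Real.smul_map_volume_mul_left hR, lintegral_smul_measure,
      lintegral_map hmeas (by fun_prop), abs_of_pos h, smul_eq_mul,
      ← lintegral_const_mul _ (by fun_prop)]
    have hae : ∀ᵐ u : ℝ, ENNReal.ofReal R * (gammaPower a (R * u) * gammaPower b (R - R * u)) =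
        gammaPower (a + b) R * ProbabilityTheory.betaPDF a b u := by
      filter_upwards [Measure.ae_ne volume 0, Measure.ae_ne volume 1] with u h₀ h₁
      exact gammaPower_scaled_mul ha hb h h₀ h₁
    have hbeta : Measurable (ProbabilityTheory.betaPDF a b) :=
      (ProbabilityTheory.measurable_betaPDFReal a b).ennreal_ofReal
    rw [lintegral_congr_ae hae, lintegral_const_mul _ hbeta,
      ProbabilityTheory.lintegral_betaPDF_eq_one ha hb, mul_one]

lemma lintegral_prod_gammaPower {n : ℕ} (a : Fin n → ℝ) (ha : ∀ i, 0 < a i) {b R : ℝ}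
    (hb : 0 < b) (hR : R ≠ 0) :
    ∫⁻ y : Fin n → ℝ, (∏ i, gammaPower (a i) (y i)) * gammaPower b (R - ∑ i, y i) =
      gammaPower (∑ i, a i + b) R := by
  induction n generalizing R with
  | zero => simp [volume_pi]
  | succ n ih =>
    have hS : 0 < ∑ i : Fin n, a i.succ + b :=
      add_pos_of_nonneg_of_pos (sum_nonneg fun i _ => (ha _).le) hb
    rw [← ((volume_preserving_piFinSuccAbove (fun _ => ℝ) (0 : Fin (n + 1))).symm).lintegral_comp_emb
      (MeasurableEquiv.measurableEmbedding _), Measure.volume_eq_prod, lintegral_prod]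
    · have hae : ∀ᵐ x : ℝ, (∫⁻ y : Fin n → ℝ,
          (∏ i, gammaPower (a i)
            ((MeasurableEquiv.piFinSuccAbove (fun _ => ℝ) (0 : Fin (n + 1))).symm (x, y) i)) *
          gammaPower b (R - ∑ i,
            (MeasurableEquiv.piFinSuccAbove (fun _ => ℝ) (0 : Fin (n + 1))).symm (x, y) i)) =
          gammaPower (a 0) x * gammaPower (∑ i : Fin n, a i.succ + b) (R - x) := by
        filter_upwards [Measure.ae_ne volume R] with x hx
        rw [← ih (fun i => a i.succ) (fun i => ha _) (sub_ne_zero.2 hx.symm),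
          ← lintegral_const_mul _ (by fun_prop)]
        refine lintegral_congr fun y => ?_
        simp [MeasurableEquiv.piFinSuccAbove, Fin.prod_univ_succ, Fin.sum_univ_succ, mul_assoc,
          sub_sub]
      rw [lintegral_congr_ae hae, lintegral_gammaPower_mul (ha 0) hS hR, Fin.sum_univ_succ,
        add_assoc]
    · refine Measurable.aemeasurable ?_
      fun_prop

lemma simplexExt_castSucc {n : ℕ} (y : Fin n → ℝ) (i : Fin n) :
    simplexExt (n + 1) y i.castSucc = y i := by
  simp [simplexExt]

lemma simplexExt_last {n : ℕ} (y : Fin n → ℝ) :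
    simplexExt (n + 1) y (Fin.last n) = 1 - ∑ i, y i := by
  simp [simplexExt]

lemma simplexExt_nonneg {n : ℕ} {y : Fin n → ℝ} (hy : y ∈ simplexDomain (n + 1))
    (m : Fin (n + 1)) : 0 ≤ simplexExt (n + 1) y m := by
  induction m using Fin.lastCases with
  | last => rw [simplexExt_last]; exact sub_nonneg.2 hy.2
  | cast i => rw [simplexExt_castSucc]; exact hy.1 i

lemma measurable_simplexExt {n : ℕ} (m : Fin (n + 1)) :
    Measurable fun y : Fin n → ℝ => simplexExt (n + 1) y m := by
  induction m using Fin.lastCases with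
  | last => simp only [simplexExt_last]; fun_prop
  | cast i => simp only [simplexExt_castSucc]; fun_prop

lemma measurableSet_simplexDomain (n : ℕ) : MeasurableSet (simplexDomain (n + 1)) := by
  have : simplexDomain (n + 1) =
      {y : Fin n → ℝ | ∀ i, 0 ≤ y i} ∩ {y : Fin n → ℝ | ∑ i, y i ≤ 1} := rfl
  rw [this, Set.ofPred_forall]
  exact (MeasurableSet.iInter fun i => measurableSet_le (by fun_prop) (by fun_prop)).inter
    (measurableSet_le (by fun_prop) (by fun_prop))

/-- The Dirichlet integral. -/
lemma setIntegral_prod_simplexExt_rpow {n : ℕ} (c : Fin (n + 1) → ℝ) (hc : ∀ m, 0 < c m) :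
    ∫ y in simplexDomain (n + 1), ∏ m, simplexExt (n + 1) y m ^ (c m - 1) =
      (∏ m, Real.Gamma (c m)) / Real.Gamma (∑ m, c m) := by
  have hG : ∀ m, 0 < Real.Gamma (c m) := fun m => Real.Gamma_pos_of_pos (hc m)
  have hGp : 0 < ∏ m, Real.Gamma (c m) := prod_pos fun m _ => hG m
  have hcast : ∀ y ∈ simplexDomain (n + 1),
      ENNReal.ofReal (∏ m, simplexExt (n + 1) y m ^ (c m - 1)) =
        ENNReal.ofReal (∏ m, Real.Gamma (c m)) * ∏ m, gammaPower (c m) (simplexExt (n + 1) y m) := by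
    intro y hy
    have hnn := simplexExt_nonneg hy
    simp only [gammaPower, hnn, if_true]
    rw [← ENNReal.ofReal_prod_of_nonneg fun m _ => div_nonneg (Real.rpow_nonneg (hnn m) _) (hG m).le,
      ← ENNReal.ofReal_mul hGp.le, prod_div_distrib, mul_div_cancel₀ _ hGp.ne']
  have hsupp : Function.support
      (fun y : Fin n → ℝ => ∏ m, gammaPower (c m) (simplexExt (n + 1) y m)) ⊆
        simplexDomain (n + 1) := by
    intro y hy
    have hnn : ∀ m, 0 ≤ simplexExt (n + 1) y m := by
      intro m
      by_contra! h
      exact hy (prod_eq_zero (mem_univ m) (gammaPower_of_neg _ h))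
    refine ⟨fun i => simplexExt_castSucc y i ▸ hnn (Fin.castSucc i), ?_⟩
    have := hnn (Fin.last n)
    rw [simplexExt_last] at this
    exact sub_nonneg.1 this
  have key : ∫⁻ y in simplexDomain (n + 1), ∏ m, gammaPower (c m) (simplexExt (n + 1) y m) =
      gammaPower (∑ m, c m) 1 := by
    refine (setLIntegral_eq_of_support_subset hsupp).trans ?_
    simp only [Fin.prod_univ_castSucc (n := n), Fin.sum_univ_castSucc (n := n),
      simplexExt_castSucc, simplexExt_last]
    exact lintegral_prod_gammaPower (fun i : Fin n => c i.castSucc) (fun i => hc _)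
      (hc (Fin.last n)) one_ne_zero
  rw [integral_eq_lintegral_of_nonneg_ae]
  · rw [setLIntegral_congr_fun (measurableSet_simplexDomain n) hcast,
      lintegral_const_mul' _ _ ENNReal.ofReal_ne_top, key]
    have hGs : 0 < Real.Gamma (∑ m, c m) :=
      Real.Gamma_pos_of_pos (sum_pos (fun m _ => hc m) univ_nonempty)
    simp only [gammaPower, zero_le_one, if_true, Real.one_rpow]
    rw [← ENNReal.ofReal_mul hGp.le, ENNReal.toReal_ofReal (by positivity), mul_one_div]
  · exact ae_restrict_of_forall_mem (measurableSet_simplexDomain n) fun y hy =>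
      prod_nonneg fun m _ => Real.rpow_nonneg (simplexExt_nonneg hy m) _
  · exact (Finset.measurable_fun_prod _ fun m _ => (measurable_simplexExt m).pow_const _).aestronglyMeasurable

lemma dirichletExpectation_mul {k : ℕ} {s : ℝ} (hs : 0 < s) {i j : Fin k} (hij : i ≠ j)
    {t : Fin k → ℝ} (ht : ∀ m, 0 < t m) (hsum : ∑ m, t m = 1) :
    dirichletExpectation k s t (fun θ => θ i * θ j) = s * t i * t j / (s + 1) := by
  obtain ⟨n, rfl⟩ : ∃ n, k = n + 1 := ⟨k - 1, by have := i.pos; omega⟩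
  have hst : ∀ m, 0 < s * t m := fun m => mul_pos hs (ht m)
  set c : Fin (n + 1) → ℝ := fun m =>
    s * t m + (if m = i then 1 else 0) + (if m = j then 1 else 0) with hc
  have hcpos : ∀ m, 0 < c m := by
    intro m
    have := hst m
    simp only [hc]
    positivity
  have hcsum : ∑ m, c m = s + 1 + 1 := by
    simp [hc, sum_add_distrib, ← mul_sum, hsum]
  have hGamma : ∏ m, Real.Gamma (c m) =
      (∏ m, Real.Gamma (s * t m)) * ((s * t i) * (s * t j)) := by
    have : ∀ m, Real.Gamma (c m) = Real.Gamma (s * t m) *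
        ((if m = i then s * t m else 1) * (if m = j then s * t m else 1)) := by
      intro m
      by_cases h₁ : m = i
      · have h₂ : m ≠ j := fun h => hij (h₁.symm.trans h)
        simp [hc, h₁, hij, Real.Gamma_add_one (hst i).ne', mul_comm]
      · by_cases h₂ : m = j
        · simp [hc, h₂, hij.symm, Real.Gamma_add_one (hst j).ne', mul_comm]
        · simp [hc, h₁, h₂]
    simp only [this, prod_mul_distrib, prod_ite_eq', mem_univ, if_true]
  have hpow : ∀ θ : Fin (n + 1) → ℝ, (∀ m, 0 ≤ θ m) →
      ∏ m, θ m ^ (c m - 1) = (∏ m, θ m ^ (s * t m - 1)) * (θ i * θ j) := by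
    intro θ hθ
    have hadd : ∀ m, θ m ^ (s * t m + 1 - 1) = θ m ^ (s * t m - 1) * θ m := by
      intro m
      conv_rhs => rw [← Real.rpow_one (θ m), ← Real.rpow_mul (hθ m), one_mul]
      rw [← Real.rpow_add' (hθ m) (by have := hst m; linarith)]
      ring_nf
    have : ∀ m, θ m ^ (c m - 1) = θ m ^ (s * t m - 1) *
        ((if m = i then θ m else 1) * (if m = j then θ m else 1)) := by
      intro m
      by_cases h₁ : m = i
      · simp only [hc, h₁, hij, if_true, if_false, add_zero, mul_one, hadd]
      · by_cases h₂ : m = j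
        · simp only [hc, h₂, hij.symm, if_true, if_false, add_zero, one_mul, hadd]
        · simp [hc, h₁, h₂]
    simp only [this, prod_mul_distrib, prod_ite_eq', mem_univ, if_true]
  have hint : dirichletExpectation (n + 1) s t (fun θ => θ i * θ j) =
      ∫ y in simplexDomain (n + 1), (Real.Gamma s / ∏ m, Real.Gamma (s * t m)) *
        ∏ m, simplexExt (n + 1) y m ^ (c m - 1) := by
    refine setIntegral_congr_fun (measurableSet_simplexDomain n) fun y hy => ?_
    simp only [hpow _ (simplexExt_nonneg hy)]
    ring
  have hprod : ∏ m, Real.Gamma (s * t m) ≠ 0 :=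
    (prod_pos fun m _ => Real.Gamma_pos_of_pos (hst m)).ne'
  have hΓ : Real.Gamma s ≠ 0 := (Real.Gamma_pos_of_pos hs).ne'
  have hs₁ : s + 1 ≠ 0 := by positivity
  rw [hint, integral_const_mul, setIntegral_prod_simplexExt_rpow c hcpos, hcsum, hGamma, Real.Gamma_add_one hs₁, Real.Gamma_add_one hs.ne']
  field_simp

lemma mul_le_quarter_of_mem_stdSimplex {ι : Type*} [Fintype ι] {θ : ι → ℝ}
    (hθ : θ ∈ stdSimplex ℝ ι) {i j : ι} (hij : i ≠ j) : θ i * θ j ≤ 1 / 4 := by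
  classical
  have hle : θ i + θ j ≤ 1 := by
    rw [← hθ.2, ← sum_pair hij]
    exact sum_le_sum_of_subset_of_nonneg (subset_univ _) fun m _ _ => hθ.1 m
  nlinarith [sq_nonneg (θ i - θ j), hθ.1 i, hθ.1 j]

/-- The midpoint of the edge of the simplex joining the vertices `i` and `j`. -/
noncomputable def edgeMidpoint {ι : Type*} [DecidableEq ι] (i j : ι) (m : ι) : ℝ :=
  (if m = i then 1 / 2 else 0) + (if m = j then 1 / 2 else 0)

lemma edgeMidpoint_mem_stdSimplex {ι : Type*} [Fintype ι] [DecidableEq ι] (i j : ι) :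
    edgeMidpoint i j ∈ stdSimplex ℝ ι := by
  refine ⟨fun m => ?_, ?_⟩
  · unfold edgeMidpoint
    positivity
  · simp only [edgeMidpoint, sum_add_distrib, sum_ite_eq', mem_univ, if_true]
    norm_num

lemma edgeMidpoint_left {ι : Type*} [DecidableEq ι] {i j : ι} (hij : i ≠ j) :
    edgeMidpoint i j i = 1 / 2 := by
  simp [edgeMidpoint, hij]

lemma edgeMidpoint_right {ι : Type*} [DecidableEq ι] {i j : ι} (hij : i ≠ j) :
    edgeMidpoint i j j = 1 / 2 := by
  simp [edgeMidpoint, hij.symm]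

lemma exists_pos_simplex_mul_ge {ι : Type*} [Fintype ι] {i j : ι} (hij : i ≠ j)
    {δ : ℝ} (hδ₀ : 0 < δ) (hδ₁ : δ < 1) :
    ∃ t : ι → ℝ, (∀ m, 0 < t m) ∧ ∑ m, t m = 1 ∧ ((1 - δ) / 2) ^ 2 ≤ t i * t j := by
  classical
  have hcard : (0 : ℝ) < Fintype.card ι := by
    exact_mod_cast Fintype.card_pos_iff.2 ⟨i⟩
  have hu : 0 < δ / Fintype.card ι := by positivity
  have hmid := edgeMidpoint_mem_stdSimplex i j
  refine ⟨fun m => (1 - δ) * edgeMidpoint i j m + δ / Fintype.card ι, fun m => ?_, ?_, ?_⟩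
  · exact add_pos_of_nonneg_of_pos (mul_nonneg (by linarith) (hmid.1 m)) hu
  · simp only [sum_add_distrib, ← mul_sum, hmid.2, sum_const, card_univ, nsmul_eq_mul]
    field_simp
    ring
  · simp only [edgeMidpoint_left hij, edgeMidpoint_right hij]
    nlinarith

/-- **The IDM near-ignorance prior is not vacuous for `θᵢ·θⱼ`.**
For `k ≥ 3`, `s > 0` and distinct indices `i ≠ j`: for every `t` in the open
simplex `T`, `E_{dir_{s,t}}[θᵢ·θⱼ] = s tᵢ tⱼ/(s+1)`; consequently
`sup_{t∈T} E_{dir_{s,t}}[θᵢ·θⱼ] = s/(4(s+1))`, which is strictly smaller than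
`sup_{θ∈Θ} θᵢ·θⱼ = 1/4`. -/
theorem idm_not_vacuous_for_product
    (k : ℕ) (hk : 3 ≤ k) (s : ℝ) (hs : 0 < s) (i j : Fin k) (hij : i ≠ j) :
    (∀ t : Fin k → ℝ, (∀ m, 0 < t m) → (∑ m, t m) = 1 →
        dirichletExpectation k s t (fun θ => θ i * θ j) = s * t i * t j / (s + 1)) ∧
    sSup {r | ∃ t : Fin k → ℝ, (∀ m, 0 < t m) ∧ (∑ m, t m) = 1 ∧
        r = dirichletExpectation k s t (fun θ => θ i * θ j)} = s / (4 * (s + 1)) ∧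
    sSup {r | ∃ θ ∈ stdSimplex ℝ (Fin k), r = θ i * θ j} = 1 / 4 ∧
    s / (4 * (s + 1)) < 1 / 4 := by
  have hE : ∀ t : Fin k → ℝ, (∀ m, 0 < t m) → (∑ m, t m) = 1 →
      dirichletExpectation k s t (fun θ => θ i * θ j) = s * t i * t j / (s + 1) :=
    fun t ht hsum => dirichletExpectation_mul hs hij ht hsum
  have hmid := edgeMidpoint_mem_stdSimplex i j
  refine ⟨hE, IsLUB.csSup_eq ⟨?_, ?_⟩ ?_, IsGreatest.csSup_eq ⟨?_, ?_⟩, ?_⟩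
  · rintro r ⟨t, ht, hsum, rfl⟩
    have hle := mul_le_quarter_of_mem_stdSimplex (θ := t) ⟨fun m => (ht m).le, hsum⟩ hij
    rw [hE t ht hsum, div_le_div_iff₀ (by positivity) (by positivity)]
    nlinarith [mul_le_mul_of_nonneg_left hle (by positivity : 0 ≤ s * (s + 1))]
  · intro b hb
    have hlim : Filter.Tendsto (fun δ : ℝ => s * ((1 - δ) / 2) ^ 2 / (s + 1))
        (nhdsWithin 0 (Set.Ioi 0)) (nhds (s / (4 * (s + 1)))) := by
      have hcont : Continuous fun δ : ℝ => s * ((1 - δ) / 2) ^ 2 / (s + 1) := by fun_prop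
      have h₀ : s * ((1 - (0 : ℝ)) / 2) ^ 2 / (s + 1) = s / (4 * (s + 1)) := by
        field_simp
        norm_num
      exact h₀ ▸ (hcont.tendsto 0).mono_left nhdsWithin_le_nhds
    refine le_of_tendsto hlim ?_
    filter_upwards [Ioo_mem_nhdsGT (zero_lt_one' ℝ)] with δ hδ
    obtain ⟨t, ht, hsum, hge⟩ := exists_pos_simplex_mul_ge hij hδ.1 hδ.2
    refine le_trans ?_ (hb ⟨t, ht, hsum, rfl⟩)
    rw [hE t ht hsum, mul_assoc]
    gcongr
  · obtain ⟨t, ht, hsum, -⟩ := exists_pos_simplex_mul_ge hij one_half_pos one_half_lt_one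
    exact ⟨_, t, ht, hsum, rfl⟩
  · refine ⟨edgeMidpoint i j, hmid, ?_⟩
    rw [edgeMidpoint_left hij, edgeMidpoint_right hij]
    norm_num
  · rintro r ⟨θ, hθ, rfl⟩
    exact mul_le_quarter_of_mem_stdSimplex hθ hij
  · rw [div_lt_div_iff₀ (by positivity) (by norm_num)]
    linarith
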